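/- Erasure subject reduction: if the erasure relation ε; ε ⊢ m ~ m' : A is derivable in empty contexts and m' program-reduces in one step to n', then there exists a term n such that m program-reduces in one step to n and ε; ε ⊢ n ~ n' : A is derivable. -/

import Mathlib

namespace TLL

/-- The two sorts of TLL: `U` (non-linear) and `L` (linear). -/
inductive Srt : Type
  | U | L
deriving DecidableEq

/-- TLL terms in de Bruijn representation: variables, sorts, the two Π-type
formers (irrelevant `pi0` and relevant `pi1`), the two λ-formers, application,
the erased constant `box`, and heap pointers `ptr`. -/
inductive Tm : Type
  | var  : Nat → Tm
  | srt  : Srt → Tm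
  | pi0  : Srt → Tm → Tm → Tm
  | pi1  : Srt → Tm → Tm → Tm
  | lam0 : Srt → Tm → Tm → Tm
  | lam1 : Srt → Tm → Tm → Tm
  | app  : Tm → Tm → Tm
  | box  : Tm
  | ptr  : Nat → Tm

def upr (ξ : Nat → Nat) : Nat → Nat
  | 0 => 0
  | n + 1 => ξ n + 1

def rename (ξ : Nat → Nat) : Tm → Tm
  | .var x => .var (ξ x)
  | .srt s => .srt s
  | .pi0 t A B => .pi0 t (rename ξ A) (rename (upr ξ) B)
  | .pi1 t A B => .pi1 t (rename ξ A) (rename (upr ξ) B)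
  | .lam0 t A m => .lam0 t (rename ξ A) (rename (upr ξ) m)
  | .lam1 t A m => .lam1 t (rename ξ A) (rename (upr ξ) m)
  | .app m n => .app (rename ξ m) (rename ξ n)
  | .box => .box
  | .ptr l => .ptr l

def up (σ : Nat → Tm) : Nat → Tm
  | 0 => .var 0
  | n + 1 => rename Nat.succ (σ n)

def subst (σ : Nat → Tm) : Tm → Tm
  | .var x => σ x
  | .srt s => .srt s
  | .pi0 t A B => .pi0 t (subst σ A) (subst (up σ) B)
  | .pi1 t A B => .pi1 t (subst σ A) (subst (up σ) B)
  | .lam0 t A m => .lam0 t (subst σ A) (subst (up σ) m)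
  | .lam1 t A m => .lam1 t (subst σ A) (subst (up σ) m)
  | .app m n => .app (subst σ m) (subst σ n)
  | .box => .box
  | .ptr l => .ptr l

/-- `subst1 n m` is `m[n/x]` for the topmost bound variable `x`. -/
def subst1 (n : Tm) (m : Tm) : Tm :=
  subst (fun i => match i with | 0 => n | i + 1 => .var i) m

/-- Logical one-step reduction `m ~> n`: full β-reduction with both β-rules,
closed under all structural subterm positions. -/
inductive LStep : Tm → Tm → Prop
  | beta0 {t A m n} : LStep (.app (.lam0 t A m) n) (subst1 n m)
  | beta1 {t A m n} : LStep (.app (.lam1 t A m) n) (subst1 n m)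
  | appL {m m' n} : LStep m m' → LStep (.app m n) (.app m' n)
  | appR {m n n'} : LStep n n' → LStep (.app m n) (.app m n')
  | pi0A {t A A' B} : LStep A A' → LStep (.pi0 t A B) (.pi0 t A' B)
  | pi0B {t A B B'} : LStep B B' → LStep (.pi0 t A B) (.pi0 t A B')
  | pi1A {t A A' B} : LStep A A' → LStep (.pi1 t A B) (.pi1 t A' B)
  | pi1B {t A B B'} : LStep B B' → LStep (.pi1 t A B) (.pi1 t A B')
  | lam0A {t A A' m} : LStep A A' → LStep (.lam0 t A m) (.lam0 t A' m)
  | lam0M {t A m m'} : LStep m m' → LStep (.lam0 t A m) (.lam0 t A m')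
  | lam1A {t A A' m} : LStep A A' → LStep (.lam1 t A m) (.lam1 t A' m)
  | lam1M {t A m m'} : LStep m m' → LStep (.lam1 t A m) (.lam1 t A m')

/-- Multi-step logical reduction. -/
abbrev LRed : Tm → Tm → Prop := Relation.ReflTransGen LStep

/-- Definitional equality `A ≃ B`: equivalence closure of logical reduction. -/
def Conv (A B : Tm) : Prop := Relation.EqvGen LStep A B

/-- Parallel logical reduction `m ⇒ n`. -/
inductive PStep : Tm → Tm → Prop
  | var {x} : PStep (.var x) (.var x)
  | srt {s} : PStep (.srt s) (.srt s)
  | box : PStep .box .box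
  | ptr {l} : PStep (.ptr l) (.ptr l)
  | pi0 {t A A' B B'} : PStep A A' → PStep B B' → PStep (.pi0 t A B) (.pi0 t A' B')
  | pi1 {t A A' B B'} : PStep A A' → PStep B B' → PStep (.pi1 t A B) (.pi1 t A' B')
  | lam0 {t A A' m m'} : PStep A A' → PStep m m' → PStep (.lam0 t A m) (.lam0 t A' m')
  | lam1 {t A A' m m'} : PStep A A' → PStep m m' → PStep (.lam1 t A m) (.lam1 t A' m')
  | app {m m' n n'} : PStep m m' → PStep n n' → PStep (.app m n) (.app m' n')
  | beta0 {t A m m' n n'} : PStep m m' → PStep n n' →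
      PStep (.app (.lam0 t A m) n) (subst1 n' m')
  | beta1 {t A m m' n n'} : PStep m m' → PStep n n' →
      PStep (.app (.lam1 t A m) n) (subst1 n' m')

/-- Logical contexts: lists of types (de Bruijn). -/
abbrev Ctx := List Tm

/-- `Has Γ x A`: variable `x` has type `A` in logical context `Γ`
(with the appropriate de Bruijn shifts). -/
inductive Has : Ctx → Nat → Tm → Prop
  | zero {Γ A} : Has (A :: Γ) 0 (rename Nat.succ A)
  | succ {Γ x A B} : Has Γ x A → Has (B :: Γ) (x + 1) (rename Nat.succ A)

mutual
/-- Well-formed logical contexts. -/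
inductive LWf : Ctx → Prop
  | nil : LWf []
  | cons {Γ A s} : LWf Γ → LTyped Γ A (.srt s) → LWf (A :: Γ)

/-- The logical typing judgment `Γ ⊢ m : A`. -/
inductive LTyped : Ctx → Tm → Tm → Prop
  | srt {Γ} (s : Srt) : LWf Γ → LTyped Γ (.srt s) (.srt .U)
  | var {Γ x A} : LWf Γ → Has Γ x A → LTyped Γ (.var x) A
  | pi0 {Γ A B s r} (t : Srt) :
      LTyped Γ A (.srt s) → LTyped (A :: Γ) B (.srt r) →
      LTyped Γ (.pi0 t A B) (.srt t)
  | pi1 {Γ A B s r} (t : Srt) :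
      LTyped Γ A (.srt s) → LTyped (A :: Γ) B (.srt r) →
      LTyped Γ (.pi1 t A B) (.srt t)
  | lam0 {Γ A B m} (t : Srt) :
      LTyped (A :: Γ) m B → LTyped Γ (.lam0 t A m) (.pi0 t A B)
  | lam1 {Γ A B m} (t : Srt) :
      LTyped (A :: Γ) m B → LTyped Γ (.lam1 t A m) (.pi1 t A B)
  | app0 {Γ m n A B t} :
      LTyped Γ m (.pi0 t A B) → LTyped Γ n A → LTyped Γ (.app m n) (subst1 n B)
  | app1 {Γ m n A B t} :
      LTyped Γ m (.pi1 t A B) → LTyped Γ n A → LTyped Γ (.app m n) (subst1 n B)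
  | conv {Γ m A B s} :
      LTyped Γ m A → LTyped Γ B (.srt s) → Conv A B → LTyped Γ m B
end

/-- Program context entries: either absent, or a sort-annotated type. -/
abbrev Entry := Option (Srt × Tm)

/-- Program contexts, positionally aligned with the logical context. -/
abbrev PCtx := List Entry

/-- The context constraint `Δ ▷ s`. -/
inductive Restr : PCtx → Srt → Prop
  | nil {s} : Restr [] s
  | skip {Δ s} : Restr Δ s → Restr ((none : Entry) :: Δ) s
  | u {Δ A} : Restr Δ .U → Restr (some (.U, A) :: Δ) .U
  | l {Δ s A} : Restr Δ .L → Restr (some (s, A) :: Δ) .L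

/-- Context merge `Δ₁ ∪̇ Δ₂ = Δ`: contraction on shared `U` entries,
`L` entries occur on exactly one side. -/
inductive Merge : PCtx → PCtx → PCtx → Prop
  | nil : Merge [] [] []
  | contra {Δ₁ Δ₂ Δ A} : Merge Δ₁ Δ₂ Δ →
      Merge (some (.U, A) :: Δ₁) (some (.U, A) :: Δ₂) (some (.U, A) :: Δ)
  | left {Δ₁ Δ₂ Δ A} : Merge Δ₁ Δ₂ Δ →
      Merge (some (.L, A) :: Δ₁) ((none : Entry) :: Δ₂) (some (.L, A) :: Δ)
  | right {Δ₁ Δ₂ Δ A} : Merge Δ₁ Δ₂ Δ →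
      Merge ((none : Entry) :: Δ₁) (some (.L, A) :: Δ₂) (some (.L, A) :: Δ)
  | skip {Δ₁ Δ₂ Δ} : Merge Δ₁ Δ₂ Δ →
      Merge ((none : Entry) :: Δ₁) ((none : Entry) :: Δ₂) ((none : Entry) :: Δ)

/-- `PHas Δ x s A`: the entry `x :s A` occurs in `Δ` and the rest of `Δ`
satisfies `▷ U` (so no linear entry is discarded). -/
inductive PHas : PCtx → Nat → Srt → Tm → Prop
  | zero {Δ s A} : Restr Δ .U → PHas (some (s, A) :: Δ) 0 s (rename Nat.succ A)
  | succN {Δ x s A} : PHas Δ x s A → PHas ((none : Entry) :: Δ) (x + 1) s (rename Nat.succ A)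
  | succU {Δ x s A B} : PHas Δ x s A → PHas (some (.U, B) :: Δ) (x + 1) s (rename Nat.succ A)

/-- Well-formed pairs of logical and program contexts `Γ ; Δ ⊢`. -/
inductive PWf : Ctx → PCtx → Prop
  | nil : PWf [] []
  | cons {Γ Δ A s} : PWf Γ Δ → LTyped Γ A (.srt s) → PWf (A :: Γ) (some (s, A) :: Δ)
  | consN {Γ Δ A s} : PWf Γ Δ → LTyped Γ A (.srt s) → PWf (A :: Γ) ((none : Entry) :: Δ)

/-- The program typing judgment `Γ ; Δ ⊢ m : A`. -/
inductive PTyped : Ctx → PCtx → Tm → Tm → Prop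
  | var {Γ Δ x s A} : PWf Γ Δ → PHas Δ x s A → PTyped Γ Δ (.var x) A
  | lam0 {Γ Δ A B m} (t : Srt) :
      PTyped (A :: Γ) ((none : Entry) :: Δ) m B → Restr Δ t →
      PTyped Γ Δ (.lam0 t A m) (.pi0 t A B)
  | lam1 {Γ Δ A B m s} (t : Srt) :
      PTyped (A :: Γ) (some (s, A) :: Δ) m B → Restr Δ t →
      PTyped Γ Δ (.lam1 t A m) (.pi1 t A B)
  | app0 {Γ Δ m n A B t} :
      PTyped Γ Δ m (.pi0 t A B) → LTyped Γ n A →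
      PTyped Γ Δ (.app m n) (subst1 n B)
  | app1 {Γ Δ₁ Δ₂ Δ m n A B t} :
      PTyped Γ Δ₁ m (.pi1 t A B) → PTyped Γ Δ₂ n A → Merge Δ₁ Δ₂ Δ →
      PTyped Γ Δ (.app m n) (subst1 n B)
  | conv {Γ Δ m A B s} :
      PTyped Γ Δ m A → LTyped Γ B (.srt s) → Conv A B →
      PTyped Γ Δ m B

/-- Program values. -/
inductive Value : Tm → Prop
  | var {x} : Value (.var x)
  | lam0 {t A m} : Value (.lam0 t A m)
  | lam1 {t A m} : Value (.lam1 t A m)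

/-- Program (call-by-value) one-step reduction `m ~~> n`. -/
inductive CStep : Tm → Tm → Prop
  | appL {m m' n} : CStep m m' → CStep (.app m n) (.app m' n)
  | appR {m n n'} : CStep n n' → CStep (.app m n) (.app m n')
  | beta0 {t A m n} : CStep (.app (.lam0 t A m) n) (subst1 n m)
  | beta1 {t A m v} : Value v → CStep (.app (.lam1 t A m) v) (subst1 v m)

/-- The erasure judgment `Γ ; Δ ⊢ m ~ m' : A`. -/
inductive Erase : Ctx → PCtx → Tm → Tm → Tm → Prop
  | var {Γ Δ x s A} : PWf Γ Δ → PHas Δ x s A → Erase Γ Δ (.var x) (.var x) A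
  | lam0 {Γ Δ A B m m'} (t : Srt) :
      Erase (A :: Γ) ((none : Entry) :: Δ) m m' B → Restr Δ t →
      Erase Γ Δ (.lam0 t A m) (.lam0 t .box m') (.pi0 t A B)
  | lam1 {Γ Δ A B m m' s} (t : Srt) :
      Erase (A :: Γ) (some (s, A) :: Δ) m m' B → Restr Δ t →
      Erase Γ Δ (.lam1 t A m) (.lam1 t .box m') (.pi1 t A B)
  | app0 {Γ Δ m m' n A B t} :
      Erase Γ Δ m m' (.pi0 t A B) → LTyped Γ n A →
      Erase Γ Δ (.app m n) (.app m' .box) (subst1 n B)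
  | app1 {Γ Δ₁ Δ₂ Δ m m' n n' A B t} :
      Erase Γ Δ₁ m m' (.pi1 t A B) → Erase Γ Δ₂ n n' A → Merge Δ₁ Δ₂ Δ →
      Erase Γ Δ (.app m n) (.app m' n') (subst1 n B)
  | conv {Γ Δ m m' A B s} :
      Erase Γ Δ m m' A → LTyped Γ B (.srt s) → Conv A B →
      Erase Γ Δ m m' B

/-- Heaps: finite maps from locations to sort-annotated values. -/
abbrev Heap := Nat → Option (Srt × Tm)

/-- Heap lookup `Lookup H₁ l v H₂`: non-linear cells persist, linear cells
are deallocated. -/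
inductive Lookup : Heap → Nat → Tm → Heap → Prop
  | u {H l v} : H l = some (.U, v) → Lookup H l v H
  | l {H l v} : H l = some (.L, v) → Lookup H l v (Function.update H l none)

/-- Heap merge `H₁ ∪̇ H₂ = H`. -/
def HMerge (H₁ H₂ H : Heap) : Prop := ∀ l,
  (H₁ l = none ∧ H₂ l = none ∧ H l = none) ∨
  (∃ v, H₁ l = some (.U, v) ∧ H₂ l = some (.U, v) ∧ H l = some (.U, v)) ∨
  (∃ v, H₁ l = some (.L, v) ∧ H₂ l = none ∧ H l = some (.L, v)) ∨
  (∃ v, H₁ l = none ∧ H₂ l = some (.L, v) ∧ H l = some (.L, v))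

/-- The heap constraint `H ▷ s`. -/
def HRestr (H : Heap) : Srt → Prop
  | .U => ∀ l s v, H l = some (s, v) → s = Srt.U
  | .L => True

/-- Heap reduction `H ; m ~~> H' ; m'`. -/
inductive HStep : Heap → Tm → Heap → Tm → Prop
  | alloc0 {H l t m} : H l = none →
      HStep H (.lam0 t .box m) (Function.update H l (some (t, .lam0 t .box m))) (.ptr l)
  | alloc1 {H l t m} : H l = none →
      HStep H (.lam1 t .box m) (Function.update H l (some (t, .lam1 t .box m))) (.ptr l)
  | appL {H H' m m' n} : HStep H m H' m' → HStep H (.app m n) H' (.app m' n)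
  | appR {H H' m n n'} : HStep H n H' n' → HStep H (.app m n) H' (.app m n')
  | beta0 {H H' l t m n} : Lookup H l (.lam0 t .box m) H' →
      HStep H (.app (.ptr l) n) H' (subst1 .box m)
  | beta1 {H H' l₁ l₂ t m} : Lookup H l₁ (.lam1 t .box m) H' →
      HStep H (.app (.ptr l₁) (.ptr l₂)) H' (subst1 (.ptr l₂) m)

/-- Pointer resolution `H ; m ~ n`. -/
inductive Resolve : Heap → Tm → Tm → Prop
  | var {H x} : HRestr H .U → Resolve H (.var x) (.var x)
  | lam0 {H t m' m} : HRestr H t → Resolve H m' m →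
      Resolve H (.lam0 t .box m') (.lam0 t .box m)
  | lam1 {H t m' m} : HRestr H t → Resolve H m' m →
      Resolve H (.lam1 t .box m') (.lam1 t .box m)
  | app0 {H m' m} : Resolve H m' m → Resolve H (.app m' .box) (.app m .box)
  | app1 {H₁ H₂ H m' m n' n} : HMerge H₁ H₂ H →
      Resolve H₁ m' m → Resolve H₂ n' n → Resolve H (.app m' n') (.app m n)
  | ptr {H H' l v' v} : Lookup H l v' H' → Resolve H' v' v → Resolve H (.ptr l) v

/-- `ClosedUnder k m`: all free de Bruijn variables of `m` are `< k`. -/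
def ClosedUnder : Nat → Tm → Prop
  | k, .var x => x < k
  | _, .srt _ => True
  | k, .pi0 _ A B => ClosedUnder k A ∧ ClosedUnder (k + 1) B
  | k, .pi1 _ A B => ClosedUnder k A ∧ ClosedUnder (k + 1) B
  | k, .lam0 _ A m => ClosedUnder k A ∧ ClosedUnder (k + 1) m
  | k, .lam1 _ A m => ClosedUnder k A ∧ ClosedUnder (k + 1) m
  | k, .app m n => ClosedUnder k m ∧ ClosedUnder k n
  | _, .box => True
  | _, .ptr _ => True

/-- WR-heaps: heaps plausibly produced by heap reduction. -/
inductive WrHeap : Heap → Prop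
  | nil : WrHeap (fun _ => none)
  | lam0 {H l t m} : ClosedUnder 1 m → WrHeap H → H l = none →
      WrHeap (Function.update H l (some (t, .lam0 t .box m)))
  | lam1 {H l t m} : ClosedUnder 1 m → WrHeap H → H l = none →
      WrHeap (Function.update H l (some (t, .lam1 t .box m)))

/-- Well-resolved `H ⊢ a ~ b ~ c : A`. -/
def WellResolved (H : Heap) (a b c A : Tm) : Prop :=
  Erase [] [] a b A ∧ Resolve H c b

/-! ### Substitution calculus -/

/-- The substitution replacing the topmost variable by `n`. -/
def inst (n : Tm) : Nat → Tm
  | 0 => n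
  | i + 1 => .var i

theorem subst1_eq (n m : Tm) : subst1 n m = subst (inst n) m := rfl

theorem up_var (ξ : Nat → Nat) : up (fun x => .var (ξ x)) = fun x => .var (upr ξ x) := by
  funext x
  cases x <;> rfl

theorem rename_eq_subst (ξ : Nat → Nat) (m : Tm) :
    rename ξ m = subst (fun x => .var (ξ x)) m := by
  induction m generalizing ξ <;> simp_all [rename, subst, up_var]

theorem up_var_id : up Tm.var = Tm.var := by
  funext x
  cases x <;> rfl

theorem subst_var (m : Tm) : subst Tm.var m = m := by
  induction m <;> simp_all [subst, up_var_id]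

theorem up_comp_upr (σ : Nat → Tm) (ξ : Nat → Nat) :
    (fun x => up σ (upr ξ x)) = up (fun x => σ (ξ x)) := by
  funext x
  cases x <;> rfl

theorem subst_rename (σ : Nat → Tm) (ξ : Nat → Nat) (m : Tm) :
    subst σ (rename ξ m) = subst (fun x => σ (ξ x)) m := by
  induction m generalizing σ ξ <;> simp_all [rename, subst, up_comp_upr]

theorem rename_rename (ζ ξ : Nat → Nat) (m : Tm) :
    rename ζ (rename ξ m) = rename (fun x => ζ (ξ x)) m := by
  rw [rename_eq_subst ζ, subst_rename, rename_eq_subst]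

theorem rename_up (ξ : Nat → Nat) (σ : Nat → Tm) :
    (fun x => rename (upr ξ) (up σ x)) = up (fun x => rename ξ (σ x)) := by
  funext x
  cases x with
  | zero => rfl
  | succ x => simp only [up, rename_rename, upr]

theorem rename_subst (ξ : Nat → Nat) (σ : Nat → Tm) (m : Tm) :
    rename ξ (subst σ m) = subst (fun x => rename ξ (σ x)) m := by
  induction m generalizing σ ξ <;> simp_all [rename, subst, rename_up]

theorem rename_succ_subst (σ : Nat → Tm) (m : Tm) :
    subst (up σ) (rename Nat.succ m) = rename Nat.succ (subst σ m) := by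
  rw [subst_rename, rename_subst]
  rfl

theorem subst_up (τ σ : Nat → Tm) :
    (fun x => subst (up τ) (up σ x)) = up (fun x => subst τ (σ x)) := by
  funext x
  cases x with
  | zero => rfl
  | succ x => simp only [up, rename_succ_subst]

theorem subst_subst (τ σ : Nat → Tm) (m : Tm) :
    subst τ (subst σ m) = subst (fun x => subst τ (σ x)) m := by
  induction m generalizing σ τ <;> simp_all [subst, subst_up]

theorem subst_inst_rename (n m : Tm) : subst (inst n) (rename Nat.succ m) = m := by
  rw [subst_rename]
  exact subst_var m

theorem subst_subst1 (σ : Nat → Tm) (n m : Tm) :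
    subst σ (subst1 n m) = subst1 (subst σ n) (subst (up σ) m) := by
  rw [subst1_eq, subst1_eq, subst_subst, subst_subst]
  congr 1
  funext x
  cases x with
  | zero => rfl
  | succ x => simp only [up, subst_inst_rename, inst, subst]

theorem rename_subst1 (ξ : Nat → Nat) (n m : Tm) :
    rename ξ (subst1 n m) = subst1 (rename ξ n) (rename (upr ξ) m) := by
  simp only [rename_eq_subst, subst_subst1, up_var]

theorem rename_upr_succ (ξ : Nat → Nat) (m : Tm) :
    rename (upr ξ) (rename Nat.succ m) = rename Nat.succ (rename ξ m) := by
  simp only [rename_rename, upr, Nat.succ_eq_add_one]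

/-! ### Confluence -/

theorem PStep.refl (m : Tm) : PStep m m := by
  induction m with
  | var => exact .var
  | srt => exact .srt
  | box => exact .box
  | ptr => exact .ptr
  | pi0 _ _ _ h₁ h₂ => exact .pi0 h₁ h₂
  | pi1 _ _ _ h₁ h₂ => exact .pi1 h₁ h₂
  | lam0 _ _ _ h₁ h₂ => exact .lam0 h₁ h₂
  | lam1 _ _ _ h₁ h₂ => exact .lam1 h₁ h₂
  | app _ _ h₁ h₂ => exact .app h₁ h₂

theorem PStep.rename {m m' : Tm} (h : PStep m m') (ξ : Nat → Nat) :
    PStep (rename ξ m) (rename ξ m') := by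
  induction h generalizing ξ with
  | var => exact .var
  | srt => exact .srt
  | box => exact .box
  | ptr => exact .ptr
  | pi0 _ _ h₁ h₂ => exact .pi0 (h₁ _) (h₂ _)
  | pi1 _ _ h₁ h₂ => exact .pi1 (h₁ _) (h₂ _)
  | lam0 _ _ h₁ h₂ => exact .lam0 (h₁ _) (h₂ _)
  | lam1 _ _ h₁ h₂ => exact .lam1 (h₁ _) (h₂ _)
  | app _ _ h₁ h₂ => exact .app (h₁ _) (h₂ _)
  | beta0 _ _ h₁ h₂ => rw [rename_subst1]; exact .beta0 (h₁ _) (h₂ _)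
  | beta1 _ _ h₁ h₂ => rw [rename_subst1]; exact .beta1 (h₁ _) (h₂ _)

theorem PStep.up {σ σ' : Nat → Tm} (h : ∀ x, PStep (σ x) (σ' x)) (x : Nat) :
    PStep (up σ x) (up σ' x) := by
  cases x with
  | zero => exact .var
  | succ x => exact (h x).rename _

theorem PStep.subst {m m' : Tm} (h : PStep m m') {σ σ' : Nat → Tm}
    (hσ : ∀ x, PStep (σ x) (σ' x)) : PStep (subst σ m) (subst σ' m') := by
  induction h generalizing σ σ' with
  | var => exact hσ _
  | srt => exact .srt
  | box => exact .box
  | ptr => exact .ptr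
  | pi0 _ _ h₁ h₂ => exact .pi0 (h₁ hσ) (h₂ (PStep.up hσ))
  | pi1 _ _ h₁ h₂ => exact .pi1 (h₁ hσ) (h₂ (PStep.up hσ))
  | lam0 _ _ h₁ h₂ => exact .lam0 (h₁ hσ) (h₂ (PStep.up hσ))
  | lam1 _ _ h₁ h₂ => exact .lam1 (h₁ hσ) (h₂ (PStep.up hσ))
  | app _ _ h₁ h₂ => exact .app (h₁ hσ) (h₂ hσ)
  | beta0 _ _ h₁ h₂ => rw [subst_subst1]; exact .beta0 (h₁ (PStep.up hσ)) (h₂ hσ)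
  | beta1 _ _ h₁ h₂ => rw [subst_subst1]; exact .beta1 (h₁ (PStep.up hσ)) (h₂ hσ)

theorem PStep.subst1 {m m' n n' : Tm} (hm : PStep m m') (hn : PStep n n') :
    PStep (subst1 n m) (subst1 n' m') := by
  rw [subst1_eq, subst1_eq]
  refine hm.subst fun x => ?_
  cases x with
  | zero => exact hn
  | succ x => exact .var

/-- Complete development: contract every redex of a term simultaneously. -/
def develop : Tm → Tm
  | .var x => .var x
  | .srt s => .srt s
  | .pi0 t A B => .pi0 t (develop A) (develop B)
  | .pi1 t A B => .pi1 t (develop A) (develop B)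
  | .lam0 t A m => .lam0 t (develop A) (develop m)
  | .lam1 t A m => .lam1 t (develop A) (develop m)
  | .app (.lam0 _ _ m) n => subst1 (develop n) (develop m)
  | .app (.lam1 _ _ m) n => subst1 (develop n) (develop m)
  | .app m n => .app (develop m) (develop n)
  | .box => .box
  | .ptr l => .ptr l

theorem PStep.triangle {m n : Tm} (h : PStep m n) : PStep n (develop m) := by
  induction h with
  | var => exact .var
  | srt => exact .srt
  | box => exact .box
  | ptr => exact .ptr
  | pi0 _ _ h₁ h₂ => exact .pi0 h₁ h₂
  | pi1 _ _ h₁ h₂ => exact .pi1 h₁ h₂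
  | lam0 _ _ h₁ h₂ => exact .lam0 h₁ h₂
  | lam1 _ _ h₁ h₂ => exact .lam1 h₁ h₂
  | @app m m' n n' hm _ h₁ h₂ =>
    cases m with
    | lam0 t A b =>
      cases hm
      cases h₁ with
      | lam0 _ hb => exact .beta0 hb h₂
    | lam1 t A b =>
      cases hm
      cases h₁ with
      | lam1 _ hb => exact .beta1 hb h₂
    | _ => exact .app h₁ h₂
  | beta0 _ _ h₁ h₂ => exact h₁.subst1 h₂
  | beta1 _ _ h₁ h₂ => exact h₁.subst1 h₂

theorem LStep.toPStep {m n : Tm} (h : LStep m n) : PStep m n := by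
  induction h with
  | beta0 => exact .beta0 (.refl _) (.refl _)
  | beta1 => exact .beta1 (.refl _) (.refl _)
  | appL _ h => exact .app h (.refl _)
  | appR _ h => exact .app (.refl _) h
  | pi0A _ h => exact .pi0 h (.refl _)
  | pi0B _ h => exact .pi0 (.refl _) h
  | pi1A _ h => exact .pi1 h (.refl _)
  | pi1B _ h => exact .pi1 (.refl _) h
  | lam0A _ h => exact .lam0 h (.refl _)
  | lam0M _ h => exact .lam0 (.refl _) h
  | lam1A _ h => exact .lam1 h (.refl _)
  | lam1M _ h => exact .lam1 (.refl _) h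

theorem Conv.refl (m : Tm) : Conv m m := Relation.EqvGen.refl m

theorem Conv.symm {m n : Tm} (h : Conv m n) : Conv n m := Relation.EqvGen.symm _ _ h

theorem Conv.trans {m n p : Tm} (h : Conv m n) (h' : Conv n p) : Conv m p :=
  Relation.EqvGen.trans _ _ _ h h'

theorem Conv.map {f : Tm → Tm} (hf : ∀ a b, LStep a b → Conv (f a) (f b)) {m n : Tm}
    (h : Conv m n) : Conv (f m) (f n) := by
  induction h with
  | rel _ _ h => exact hf _ _ h
  | refl => exact .refl _
  | symm _ _ _ h => exact h.symm
  | trans _ _ _ _ _ h₁ h₂ => exact h₁.trans h₂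

theorem Conv.congr₂ {f : Tm → Tm → Tm}
    (hl : ∀ a b c, LStep a b → LStep (f a c) (f b c))
    (hr : ∀ a b c, LStep b c → LStep (f a b) (f a c))
    {a a' b b' : Tm} (ha : Conv a a') (hb : Conv b b') : Conv (f a b) (f a' b') :=
  (ha.map (f := fun x => f x b) fun _ _ h => .rel _ _ (hl _ _ _ h)).trans
    (hb.map (f := f a') fun _ _ h => .rel _ _ (hr _ _ _ h))

theorem PStep.toConv {m n : Tm} (h : PStep m n) : Conv m n := by
  have app {a a' b b' : Tm} (ha : Conv a a') (hb : Conv b b') :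
      Conv (.app a b) (.app a' b') :=
    ha.congr₂ (f := .app) (fun _ _ _ => .appL) (fun _ _ _ => .appR) hb
  have lam0 {t : Srt} {a a' b b' : Tm} (ha : Conv a a') (hb : Conv b b') :
      Conv (.lam0 t a b) (.lam0 t a' b') :=
    ha.congr₂ (f := .lam0 t) (fun _ _ _ => .lam0A) (fun _ _ _ => .lam0M) hb
  have lam1 {t : Srt} {a a' b b' : Tm} (ha : Conv a a') (hb : Conv b b') :
      Conv (.lam1 t a b) (.lam1 t a' b') :=
    ha.congr₂ (f := .lam1 t) (fun _ _ _ => .lam1A) (fun _ _ _ => .lam1M) hb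
  induction h with
  | var | srt | box | ptr => exact .refl _
  | @pi0 t _ _ _ _ _ _ h₁ h₂ =>
    exact h₁.congr₂ (f := .pi0 t) (fun _ _ _ => .pi0A) (fun _ _ _ => .pi0B) h₂
  | @pi1 t _ _ _ _ _ _ h₁ h₂ =>
    exact h₁.congr₂ (f := .pi1 t) (fun _ _ _ => .pi1A) (fun _ _ _ => .pi1B) h₂
  | lam0 _ _ h₁ h₂ => exact lam0 h₁ h₂
  | lam1 _ _ h₁ h₂ => exact lam1 h₁ h₂
  | app _ _ h₁ h₂ => exact app h₁ h₂
  | beta0 _ _ h₁ h₂ => exact (app (lam0 (.refl _) h₁) h₂).trans (.rel _ _ .beta0)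
  | beta1 _ _ h₁ h₂ => exact (app (lam1 (.refl _) h₁) h₂).trans (.rel _ _ .beta1)

theorem Conv.subst {m n : Tm} (h : Conv m n) (σ : Nat → Tm) :
    Conv (subst σ m) (subst σ n) :=
  h.map fun _ _ h => (h.toPStep.subst fun _ => .refl _).toConv

theorem Conv.rename {m n : Tm} (h : Conv m n) (ξ : Nat → Nat) :
    Conv (rename ξ m) (rename ξ n) := by
  simpa only [rename_eq_subst] using h.subst _

abbrev PRed : Tm → Tm → Prop := Relation.ReflTransGen PStep

theorem Conv.join {m n : Tm} (h : Conv m n) : Relation.Join PRed m n := by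
  have diamond : ∀ a b c, PStep a b → PStep a c →
      ∃ d, Relation.ReflGen PStep b d ∧ PRed c d := fun a _ _ hb hc =>
    ⟨develop a, .single hb.triangle, .single hc.triangle⟩
  have equiv := Relation.equivalence_join_reflTransGen diamond
  induction h with
  | rel _ n h => exact ⟨n, .single h.toPStep, .refl⟩
  | refl m => exact equiv.refl m
  | symm _ _ _ h => exact equiv.symm h
  | trans _ _ _ _ _ h₁ h₂ => exact equiv.trans h₁ h₂

theorem PRed.toConv {m n : Tm} (h : PRed m n) : Conv m n := by
  induction h with
  | refl => exact .refl _
  | tail _ h ih => exact ih.trans h.toConv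

theorem PRed.pi0_inv {t : Srt} {A B C : Tm} (h : PRed (.pi0 t A B) C) :
    ∃ A' B', C = .pi0 t A' B' ∧ PRed A A' ∧ PRed B B' := by
  induction h with
  | refl => exact ⟨A, B, rfl, .refl, .refl⟩
  | tail _ h ih =>
    obtain ⟨A', B', rfl, hA, hB⟩ := ih
    cases h with
    | pi0 h₁ h₂ => exact ⟨_, _, rfl, hA.tail h₁, hB.tail h₂⟩

theorem PRed.pi1_inv {t : Srt} {A B C : Tm} (h : PRed (.pi1 t A B) C) :
    ∃ A' B', C = .pi1 t A' B' ∧ PRed A A' ∧ PRed B B' := by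
  induction h with
  | refl => exact ⟨A, B, rfl, .refl, .refl⟩
  | tail _ h ih =>
    obtain ⟨A', B', rfl, hA, hB⟩ := ih
    cases h with
    | pi1 h₁ h₂ => exact ⟨_, _, rfl, hA.tail h₁, hB.tail h₂⟩

theorem Conv.pi0_inj {t t' : Srt} {A A' B B' : Tm} (h : Conv (.pi0 t A B) (.pi0 t' A' B')) :
    Conv A A' ∧ Conv B B' := by
  obtain ⟨C, h₁, h₂⟩ := h.join
  obtain ⟨A₁, B₁, rfl, hA, hB⟩ := PRed.pi0_inv h₁
  obtain ⟨A₂, B₂, e, hA', hB'⟩ := PRed.pi0_inv h₂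
  cases e
  exact ⟨(PRed.toConv hA).trans (PRed.toConv hA').symm,
    (PRed.toConv hB).trans (PRed.toConv hB').symm⟩

theorem Conv.pi1_inj {t t' : Srt} {A A' B B' : Tm} (h : Conv (.pi1 t A B) (.pi1 t' A' B')) :
    Conv A A' ∧ Conv B B' := by
  obtain ⟨C, h₁, h₂⟩ := h.join
  obtain ⟨A₁, B₁, rfl, hA, hB⟩ := PRed.pi1_inv h₁
  obtain ⟨A₂, B₂, e, hA', hB'⟩ := PRed.pi1_inv h₂
  cases e
  exact ⟨(PRed.toConv hA).trans (PRed.toConv hA').symm,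
    (PRed.toConv hB).trans (PRed.toConv hB').symm⟩

theorem Conv.pi0_ne_pi1 {t t' : Srt} {A A' B B' : Tm} :
    ¬ Conv (.pi0 t A B) (.pi1 t' A' B') := by
  intro h
  obtain ⟨C, h₁, h₂⟩ := h.join
  obtain ⟨_, _, rfl, _, _⟩ := PRed.pi0_inv h₁
  obtain ⟨_, _, e, _, _⟩ := PRed.pi1_inv h₂
  cases e

/-! ### Logical typing -/

/-- Every type of a context is well-sorted, by a derivation satisfying `P`. -/
def CtxAll (P : ∀ Γ m A, LTyped Γ m A → Prop) : Ctx → Prop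
  | [] => True
  | A :: Γ => CtxAll P Γ ∧ ∃ s, ∃ h : LTyped Γ A (.srt s), P Γ A (.srt s) h

/-- Induction on logical typing derivations in which the λ-cases also provide the
derivation, and the induction hypothesis, for the domain of the abstraction. -/
theorem LTyped.induct {P : ∀ Γ m A, LTyped Γ m A → Prop}
    (srt : ∀ {Γ} (s : Srt) (h : LWf Γ), P _ _ _ (.srt s h))
    (var : ∀ {Γ x A} (h : LWf Γ) (hx : Has Γ x A), P _ _ _ (.var h hx))
    (pi0 : ∀ {Γ A B s r} (t : Srt) (hA : LTyped Γ A (.srt s))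
      (hB : LTyped (A :: Γ) B (.srt r)), P _ _ _ hA → P _ _ _ hB → P _ _ _ (.pi0 t hA hB))
    (pi1 : ∀ {Γ A B s r} (t : Srt) (hA : LTyped Γ A (.srt s))
      (hB : LTyped (A :: Γ) B (.srt r)), P _ _ _ hA → P _ _ _ hB → P _ _ _ (.pi1 t hA hB))
    (lam0 : ∀ {Γ A B m s} (t : Srt) (hA : LTyped Γ A (.srt s)) (hm : LTyped (A :: Γ) m B),
      P _ _ _ hA → P _ _ _ hm → P _ _ _ (.lam0 t hm))
    (lam1 : ∀ {Γ A B m s} (t : Srt) (hA : LTyped Γ A (.srt s)) (hm : LTyped (A :: Γ) m B),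
      P _ _ _ hA → P _ _ _ hm → P _ _ _ (.lam1 t hm))
    (app0 : ∀ {Γ m n A B t} (hm : LTyped Γ m (.pi0 t A B)) (hn : LTyped Γ n A),
      P _ _ _ hm → P _ _ _ hn → P _ _ _ (.app0 hm hn))
    (app1 : ∀ {Γ m n A B t} (hm : LTyped Γ m (.pi1 t A B)) (hn : LTyped Γ n A),
      P _ _ _ hm → P _ _ _ hn → P _ _ _ (.app1 hm hn))
    (conv : ∀ {Γ m A B s} (hm : LTyped Γ m A) (hB : LTyped Γ B (.srt s)) (c : Conv A B),
      P _ _ _ hm → P _ _ _ hB → P _ _ _ (.conv hm hB c))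
    {Γ : Ctx} {m A : Tm} (h : LTyped Γ m A) : P Γ m A h :=
  (LTyped.rec (motive_1 := fun Γ _ => CtxAll P Γ)
    (motive_2 := fun Γ m A h => P Γ m A h ∧ CtxAll P Γ)
    trivial
    (fun _ hA ih₁ ih₂ => ⟨ih₁, _, hA, ih₂.1⟩)
    (fun s h ih => ⟨srt s h, ih⟩)
    (fun h hx ih => ⟨var h hx, ih⟩)
    (fun t h₁ h₂ ih₁ ih₂ => ⟨pi0 t h₁ h₂ ih₁.1 ih₂.1, ih₁.2⟩)
    (fun t h₁ h₂ ih₁ ih₂ => ⟨pi1 t h₁ h₂ ih₁.1 ih₂.1, ih₁.2⟩)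
    (fun t h ih => ⟨ih.2.2.elim fun _ hA => hA.elim fun hA hP => lam0 t hA h hP ih.1, ih.2.1⟩)
    (fun t h ih => ⟨ih.2.2.elim fun _ hA => hA.elim fun hA hP => lam1 t hA h hP ih.1, ih.2.1⟩)
    (fun h₁ h₂ ih₁ ih₂ => ⟨app0 h₁ h₂ ih₁.1 ih₂.1, ih₁.2⟩)
    (fun h₁ h₂ ih₁ ih₂ => ⟨app1 h₁ h₂ ih₁.1 ih₂.1, ih₁.2⟩)
    (fun h₁ h₂ c ih₁ ih₂ => ⟨conv h₁ h₂ c ih₁.1 ih₂.1, ih₁.2⟩)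
    h).1

theorem LTyped.wf {Γ : Ctx} {m A : Tm} (h : LTyped Γ m A) : LWf Γ := by
  induction h using LTyped.induct <;> assumption

theorem LTyped.rename {Γ : Ctx} {m A : Tm} (h : LTyped Γ m A) {ξ : Nat → Nat} {Γ' : Ctx}
    (hΓ' : LWf Γ') (hξ : ∀ x A, Has Γ x A → Has Γ' (ξ x) (rename ξ A)) :
    LTyped Γ' (rename ξ m) (rename ξ A) := by
  have lift {Γ Γ' : Ctx} {ξ : Nat → Nat} (A : Tm)
      (hξ : ∀ x A, Has Γ x A → Has Γ' (ξ x) (TLL.rename ξ A)) (x : Nat) (B : Tm)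
      (hx : Has (A :: Γ) x B) :
      Has (TLL.rename ξ A :: Γ') (upr ξ x) (TLL.rename (upr ξ) B) := by
    cases hx with
    | zero => rw [rename_upr_succ]; exact .zero
    | succ hx => rw [rename_upr_succ]; exact .succ (hξ _ _ hx)
  induction h using LTyped.induct generalizing ξ Γ' with
  | srt s _ => exact .srt s hΓ'
  | var _ hx => exact .var hΓ' (hξ _ _ hx)
  | pi0 t _ _ ih₁ ih₂ =>
    exact .pi0 t (ih₁ hΓ' hξ) (ih₂ (.cons hΓ' (ih₁ hΓ' hξ)) (lift _ hξ))
  | pi1 t _ _ ih₁ ih₂ =>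
    exact .pi1 t (ih₁ hΓ' hξ) (ih₂ (.cons hΓ' (ih₁ hΓ' hξ)) (lift _ hξ))
  | lam0 t _ _ ih₁ ih₂ => exact .lam0 t (ih₂ (.cons hΓ' (ih₁ hΓ' hξ)) (lift _ hξ))
  | lam1 t _ _ ih₁ ih₂ => exact .lam1 t (ih₂ (.cons hΓ' (ih₁ hΓ' hξ)) (lift _ hξ))
  | app0 _ _ ih₁ ih₂ => rw [rename_subst1]; exact .app0 (ih₁ hΓ' hξ) (ih₂ hΓ' hξ)
  | app1 _ _ ih₁ ih₂ => rw [rename_subst1]; exact .app1 (ih₁ hΓ' hξ) (ih₂ hΓ' hξ)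
  | conv _ _ c ih₁ ih₂ => exact .conv (ih₁ hΓ' hξ) (ih₂ hΓ' hξ) (c.rename ξ)

theorem LTyped.weaken {Γ : Ctx} {m A B : Tm} {s : Srt} (h : LTyped Γ m A)
    (hB : LTyped Γ B (.srt s)) :
    LTyped (B :: Γ) (TLL.rename Nat.succ m) (TLL.rename Nat.succ A) :=
  h.rename (.cons hB.wf hB) fun _ _ => .succ

/-- `σ` maps the variables of `Γ` to terms over `Γ'` of the corresponding types. -/
def LSubst (σ : Nat → Tm) (Γ Γ' : Ctx) : Prop :=
  ∀ x A, Has Γ x A → LTyped Γ' (σ x) (subst σ A)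

theorem LSubst.up {σ : Nat → Tm} {Γ Γ' : Ctx} {A : Tm} {s : Srt} (hσ : LSubst σ Γ Γ')
    (hA : LTyped Γ' (subst σ A) (.srt s)) : LSubst (up σ) (A :: Γ) (subst σ A :: Γ') := by
  intro x B hx
  cases hx with
  | zero => rw [rename_succ_subst]; exact .var (.cons hA.wf hA) .zero
  | succ hx => rw [rename_succ_subst]; exact (hσ _ _ hx).weaken hA

theorem LTyped.subst {Γ : Ctx} {m A : Tm} (h : LTyped Γ m A) {σ : Nat → Tm} {Γ' : Ctx}
    (hΓ' : LWf Γ') (hσ : LSubst σ Γ Γ') : LTyped Γ' (subst σ m) (subst σ A) := by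
  induction h using LTyped.induct generalizing σ Γ' with
  | srt s _ => exact .srt s hΓ'
  | var _ hx => exact hσ _ _ hx
  | pi0 t _ _ ih₁ ih₂ =>
    exact .pi0 t (ih₁ hΓ' hσ) (ih₂ (.cons hΓ' (ih₁ hΓ' hσ)) (hσ.up (ih₁ hΓ' hσ)))
  | pi1 t _ _ ih₁ ih₂ =>
    exact .pi1 t (ih₁ hΓ' hσ) (ih₂ (.cons hΓ' (ih₁ hΓ' hσ)) (hσ.up (ih₁ hΓ' hσ)))
  | lam0 t _ _ ih₁ ih₂ =>
    exact .lam0 t (ih₂ (.cons hΓ' (ih₁ hΓ' hσ)) (hσ.up (ih₁ hΓ' hσ)))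
  | lam1 t _ _ ih₁ ih₂ =>
    exact .lam1 t (ih₂ (.cons hΓ' (ih₁ hΓ' hσ)) (hσ.up (ih₁ hΓ' hσ)))
  | app0 _ _ ih₁ ih₂ => rw [subst_subst1]; exact .app0 (ih₁ hΓ' hσ) (ih₂ hΓ' hσ)
  | app1 _ _ ih₁ ih₂ => rw [subst_subst1]; exact .app1 (ih₁ hΓ' hσ) (ih₂ hΓ' hσ)
  | conv _ _ c ih₁ ih₂ => exact .conv (ih₁ hΓ' hσ) (ih₂ hΓ' hσ) (c.subst σ)

theorem LSubst.inst {Γ : Ctx} {n A : Tm} (hn : LTyped Γ n A) :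
    LSubst (inst n) (A :: Γ) Γ := by
  intro x B hx
  cases hx with
  | zero => rw [subst_inst_rename]; exact hn
  | succ hx => rw [subst_inst_rename]; exact .var hn.wf hx

theorem LTyped.subst1 {Γ : Ctx} {m n A B : Tm} (h : LTyped (A :: Γ) m B)
    (hn : LTyped Γ n A) : LTyped Γ (subst1 n m) (subst1 n B) := by
  rw [subst1_eq, subst1_eq]
  exact h.subst hn.wf (.inst hn)

theorem LTyped.pi0_inv {Γ : Ctx} {t : Srt} {A B C : Tm} (h : LTyped Γ (.pi0 t A B) C) :
    ∃ s, LTyped (A :: Γ) B (.srt s) := by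
  generalize hm : Tm.pi0 t A B = m at h
  induction h using LTyped.induct with
  | pi0 _ _ hB => cases hm; exact ⟨_, hB⟩
  | conv _ _ _ ih => exact ih hm
  | _ => cases hm

theorem LTyped.pi1_inv {Γ : Ctx} {t : Srt} {A B C : Tm} (h : LTyped Γ (.pi1 t A B) C) :
    ∃ s, LTyped (A :: Γ) B (.srt s) := by
  generalize hm : Tm.pi1 t A B = m at h
  induction h using LTyped.induct with
  | pi1 _ _ hB => cases hm; exact ⟨_, hB⟩
  | conv _ _ _ ih => exact ih hm
  | _ => cases hm

theorem Has.sorted {Γ : Ctx} {x : Nat} {A : Tm} (hx : Has Γ x A) (hΓ : LWf Γ) :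
    ∃ s, LTyped Γ A (.srt s) := by
  induction hx with
  | zero => cases hΓ with
    | cons _ hA => exact ⟨_, hA.weaken hA⟩
  | succ _ ih => cases hΓ with
    | cons hΓ hB => exact (ih hΓ).imp fun _ h => h.weaken hB

/-- The type of a well-typed term is well-sorted. -/
theorem LTyped.validity {Γ : Ctx} {m A : Tm} (h : LTyped Γ m A) :
    ∃ s, LTyped Γ A (.srt s) := by
  induction h using LTyped.induct with
  | srt _ hΓ => exact ⟨_, .srt _ hΓ⟩
  | var hΓ hx => exact hx.sorted hΓ
  | pi0 _ hA => exact ⟨_, .srt _ hA.wf⟩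
  | pi1 _ hA => exact ⟨_, .srt _ hA.wf⟩
  | lam0 t hA _ _ ih => exact ih.elim fun _ hB => ⟨t, .pi0 t hA hB⟩
  | lam1 t hA _ _ ih => exact ih.elim fun _ hB => ⟨t, .pi1 t hA hB⟩
  | app0 _ hn ih =>
    obtain ⟨_, h⟩ := ih
    exact h.pi0_inv.imp fun _ hB => hB.subst1 hn
  | app1 _ hn ih =>
    obtain ⟨_, h⟩ := ih
    exact h.pi1_inv.imp fun _ hB => hB.subst1 hn
  | conv _ hB => exact ⟨_, hB⟩

/-! ### Program contexts and the erasure relation -/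

theorem PWf.wf {Γ : Ctx} {Δ : PCtx} (h : PWf Γ Δ) : LWf Γ := by
  induction h with
  | nil => exact .nil
  | cons _ hA ih => exact .cons ih hA
  | consN _ hA ih => exact .cons ih hA

theorem PHas.toHas {Γ : Ctx} {Δ : PCtx} {x : Nat} {s : Srt} {A : Tm} (hx : PHas Δ x s A)
    (h : PWf Γ Δ) : Has Γ x A := by
  induction hx generalizing Γ with
  | zero => cases h; exact .zero
  | succN _ ih => cases h with
    | consN h => exact .succ (ih h)
  | succU _ ih => cases h with
    | cons h => exact .succ (ih h)

theorem Erase.typed {Γ : Ctx} {Δ : PCtx} {m m' A : Tm} (h : Erase Γ Δ m m' A) :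
    LTyped Γ m A := by
  induction h with
  | var h hx => exact .var h.wf (hx.toHas h)
  | lam0 t _ _ ih => exact .lam0 t ih
  | lam1 t _ _ ih => exact .lam1 t ih
  | app0 _ hn ih => exact .app0 ih hn
  | app1 _ _ _ ih₁ ih₂ => exact .app1 ih₁ ih₂
  | conv _ hB c ih => exact .conv ih hB c

/-- The action of a substitution on a program context entry. -/
def Entry.subst (σ : Nat → Tm) (e : Entry) : Entry := e.map fun p => (p.1, TLL.subst σ p.2)

/-- Extends a relation between substitution pairs and contexts under binders. -/
inductive Lift (R : (Nat → Tm) → (Nat → Tm) → Ctx → PCtx → Ctx → PCtx → Prop) :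
    (Nat → Tm) → (Nat → Tm) → Ctx → PCtx → Ctx → PCtx → Prop
  | base {σ σ' Γ Δ Γ' Δ'} : R σ σ' Γ Δ Γ' Δ' → Lift R σ σ' Γ Δ Γ' Δ'
  | up {σ σ' Γ Δ Γ' Δ'} (A : Tm) (e : Entry) : Lift R σ σ' Γ Δ Γ' Δ' →
      Lift R (up σ) (up σ') (A :: Γ) (e :: Δ) (subst σ A :: Γ') (e.subst σ :: Δ')

/-- The conditions under which the pairs of substitutions related by `R`, one for source
terms and one for erased terms, preserve erasure. -/
structure Admissible (R : (Nat → Tm) → (Nat → Tm) → Ctx → PCtx → Ctx → PCtx → Prop) :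
    Prop where
  wf : ∀ {σ σ' Γ Δ Γ' Δ'}, R σ σ' Γ Δ Γ' Δ' → LWf Γ → LWf Γ' ∧ LSubst σ Γ Γ'
  pwf : ∀ {σ σ' Γ Δ Γ' Δ'}, R σ σ' Γ Δ Γ' Δ' → PWf Γ Δ → PWf Γ' Δ'
  restr : ∀ {σ σ' Γ Δ Γ' Δ' t}, R σ σ' Γ Δ Γ' Δ' → Restr Δ t → Restr Δ' t
  merge : ∀ {σ σ' Γ Δ Γ' Δ' Δ₁ Δ₂}, R σ σ' Γ Δ Γ' Δ' → Merge Δ₁ Δ₂ Δ →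
    ∃ Δ₁' Δ₂', Merge Δ₁' Δ₂' Δ' ∧ R σ σ' Γ Δ₁ Γ' Δ₁' ∧ R σ σ' Γ Δ₂ Γ' Δ₂'

section
variable {R : (Nat → Tm) → (Nat → Tm) → Ctx → PCtx → Ctx → PCtx → Prop}

theorem Admissible.lift_wf (hR : Admissible R) {σ σ' : Nat → Tm} {Γ Γ' : Ctx} {Δ Δ' : PCtx}
    (h : Lift R σ σ' Γ Δ Γ' Δ') (hΓ : LWf Γ) : LWf Γ' ∧ LSubst σ Γ Γ' := by
  induction h with
  | base h => exact hR.wf h hΓ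
  | up A e _ ih => cases hΓ with
    | cons hΓ hA =>
      obtain ⟨hΓ', hσ⟩ := ih hΓ
      have hA' := hA.subst hΓ' hσ
      exact ⟨.cons hΓ' hA', hσ.up hA'⟩

theorem Admissible.lift (hR : Admissible R) : Admissible (Lift R) where
  wf := hR.lift_wf
  pwf := by
    intro σ σ' Γ Δ Γ' Δ' h hΓ
    induction h with
    | base h => exact hR.pwf h hΓ
    | up A e h ih =>
      obtain ⟨hΓ', hσ⟩ := hR.lift_wf h (by cases hΓ <;> exact PWf.wf ‹_›)
      cases hΓ with
      | cons hΓ hA => exact .cons (ih hΓ) (hA.subst hΓ' hσ)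
      | consN hΓ hA => exact .consN (ih hΓ) (hA.subst hΓ' hσ)
  restr := by
    intro σ σ' Γ Δ Γ' Δ' t h hΔ
    induction h generalizing t with
    | base h => exact hR.restr h hΔ
    | up A e _ ih => cases hΔ with
      | skip h => exact .skip (ih h)
      | u h => exact .u (ih h)
      | l h => exact .l (ih h)
  merge := by
    intro σ σ' Γ Δ Γ' Δ' Δ₁ Δ₂ h hm
    induction h generalizing Δ₁ Δ₂ with
    | base h =>
      obtain ⟨Δ₁', Δ₂', hm, h₁, h₂⟩ := hR.merge h hm
      exact ⟨Δ₁', Δ₂', hm, .base h₁, .base h₂⟩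
    | up A e _ ih =>
      cases hm with
      | contra hm =>
        obtain ⟨Δ₁', Δ₂', hm, h₁, h₂⟩ := ih hm
        exact ⟨_, _, .contra hm, .up _ _ h₁, .up _ _ h₂⟩
      | left hm =>
        obtain ⟨Δ₁', Δ₂', hm, h₁, h₂⟩ := ih hm
        exact ⟨_, _, .left hm, .up _ _ h₁, .up _ none h₂⟩
      | right hm =>
        obtain ⟨Δ₁', Δ₂', hm, h₁, h₂⟩ := ih hm
        exact ⟨_, _, .right hm, .up _ none h₁, .up _ _ h₂⟩
      | skip hm =>
        obtain ⟨Δ₁', Δ₂', hm, h₁, h₂⟩ := ih hm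
        exact ⟨_, _, .skip hm, .up _ none h₁, .up _ none h₂⟩

theorem Erase.subst_of_lift (hR : Admissible R)
    (hvar : ∀ {σ σ' Γ Δ Γ' Δ' x s A}, Lift R σ σ' Γ Δ Γ' Δ' → PWf Γ Δ → PHas Δ x s A →
      Erase Γ' Δ' (σ x) (σ' x) (subst σ A))
    {σ σ' : Nat → Tm} {Γ Γ' : Ctx} {Δ Δ' : PCtx} {m m' A : Tm}
    (hσ : Lift R σ σ' Γ Δ Γ' Δ') (h : Erase Γ Δ m m' A) :
    Erase Γ' Δ' (subst σ m) (subst σ' m') (subst σ A) := by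
  induction h generalizing σ σ' Γ' Δ' with
  | var h hx => exact hvar hσ h hx
  | lam0 t _ hΔ ih => exact .lam0 t (ih (hσ.up _ none)) (hR.lift.restr hσ hΔ)
  | lam1 t _ hΔ ih => exact .lam1 t (ih (hσ.up _ (some _))) (hR.lift.restr hσ hΔ)
  | app0 _ hn ih =>
    obtain ⟨hΓ', hs⟩ := hR.lift.wf hσ hn.wf
    rw [subst_subst1]
    exact .app0 (ih hσ) (hn.subst hΓ' hs)
  | app1 _ _ hm ih₁ ih₂ =>
    obtain ⟨_, _, hm', h₁, h₂⟩ := hR.lift.merge hσ hm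
    rw [subst_subst1]
    exact .app1 (ih₁ h₁) (ih₂ h₂) hm'
  | conv _ hB c ih =>
    obtain ⟨hΓ', hs⟩ := hR.lift.wf hσ hB.wf
    exact .conv (ih hσ) (hB.subst hΓ' hs) (c.subst σ)

end

/-- Weakening by one entry that is either absent or non-linear. -/
inductive Shift : (Nat → Tm) → (Nat → Tm) → Ctx → PCtx → Ctx → PCtx → Prop
  | none {Γ Δ B s} : LTyped Γ B (.srt s) →
      Shift (fun x => .var (x + 1)) (fun x => .var (x + 1)) Γ Δ (B :: Γ) ((none : Entry) :: Δ)
  | unr {Γ Δ B} : LTyped Γ B (.srt .U) →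
      Shift (fun x => .var (x + 1)) (fun x => .var (x + 1)) Γ Δ (B :: Γ) (some (.U, B) :: Δ)

theorem LSubst.shift {Γ : Ctx} {B : Tm} {s : Srt} (hB : LTyped Γ B (.srt s)) :
    LSubst (fun x => .var (x + 1)) Γ (B :: Γ) := by
  intro x A hx
  rw [← rename_eq_subst]
  exact .var (.cons hB.wf hB) (.succ hx)

theorem Shift.admissible : Admissible Shift where
  wf
    | .none hB, hΓ => ⟨.cons hΓ hB, .shift hB⟩
    | .unr hB, hΓ => ⟨.cons hΓ hB, .shift hB⟩
  pwf
    | .none hB, hΓ => .consN hΓ hB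
    | .unr hB, hΓ => .cons hΓ hB
  restr := by
    rintro σ σ' Γ Δ Γ' Δ' t (_ | _) hΔ
    · exact .skip hΔ
    · cases t
      · exact .u hΔ
      · exact .l hΔ
  merge
    | .none hB, hm => ⟨_, _, .skip hm, .none hB, .none hB⟩
    | .unr hB, hm => ⟨_, _, .contra hm, .unr hB, .unr hB⟩

theorem Shift.lift_var {σ σ' : Nat → Tm} {Γ Γ' : Ctx} {Δ Δ' : PCtx} {x : Nat} {s : Srt}
    {A : Tm} (h : Lift Shift σ σ' Γ Δ Γ' Δ') (hx : PHas Δ x s A) :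
    ∃ y, σ x = .var y ∧ σ' x = .var y ∧ PHas Δ' y s (subst σ A) := by
  induction h generalizing x s A with
  | base h =>
    cases h with
    | none => exact ⟨_, rfl, rfl, by rw [← rename_eq_subst]; exact .succN hx⟩
    | unr => exact ⟨_, rfl, rfl, by rw [← rename_eq_subst]; exact .succU hx⟩
  | up B e h ih =>
    cases hx with
    | zero hΔ =>
      rw [rename_succ_subst]
      exact ⟨0, rfl, rfl, .zero (Shift.admissible.lift.restr h hΔ)⟩
    | succN hx =>
      obtain ⟨y, h₁, h₂, hy⟩ := ih hx
      rw [rename_succ_subst]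
      exact ⟨y + 1, by simp only [up, h₁, rename], by simp only [up, h₂, rename], .succN hy⟩
    | succU hx =>
      obtain ⟨y, h₁, h₂, hy⟩ := ih hx
      rw [rename_succ_subst]
      exact ⟨y + 1, by simp only [up, h₁, rename], by simp only [up, h₂, rename], .succU hy⟩

theorem Erase.shift {Γ Γ' : Ctx} {Δ Δ' : PCtx} {m m' A : Tm} (h : Erase Γ Δ m m' A)
    (hs : Shift (fun x => .var (x + 1)) (fun x => .var (x + 1)) Γ Δ Γ' Δ') :
    Erase Γ' Δ' (rename Nat.succ m) (rename Nat.succ m') (rename Nat.succ A) := by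
  simp only [rename_eq_subst Nat.succ]
  refine h.subst_of_lift Shift.admissible ?_ (.base hs)
  intro σ σ' Γ Δ Γ' Δ' x s A hσ hΓ hx
  obtain ⟨y, h₁, h₂, hy⟩ := Shift.lift_var hσ hx
  rw [h₁, h₂]
  exact .var (Shift.admissible.lift.pwf hσ hΓ) hy

/-- Instantiation of the only variable of a context by a closed term. -/
inductive Inst : (Nat → Tm) → (Nat → Tm) → Ctx → PCtx → Ctx → PCtx → Prop
  | irrelevant {n n' A} : LTyped [] n A → Inst (inst n) (inst n') [A] [none] [] []
  | relevant {n n' A s} : Erase [] [] n n' A →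
      Inst (inst n) (inst n') [A] [some (s, A)] [] []

theorem Inst.admissible : Admissible Inst where
  wf
    | .irrelevant hn, _ => ⟨.nil, .inst hn⟩
    | .relevant hn, _ => ⟨.nil, .inst hn.typed⟩
  pwf
    | .irrelevant _, _ => .nil
    | .relevant _, _ => .nil
  restr
    | .irrelevant _, _ => .nil
    | .relevant _, _ => .nil
  merge := by
    rintro σ σ' Γ Δ Γ' Δ' Δ₁ Δ₂ (hn | hn) hm
    · cases hm with
      | skip hm => cases hm; exact ⟨_, _, .nil, .irrelevant hn, .irrelevant hn⟩
    · cases hm with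
      | contra hm => cases hm; exact ⟨_, _, .nil, .relevant hn, .relevant hn⟩
      | left hm => cases hm; exact ⟨_, _, .nil, .relevant hn, .irrelevant hn.typed⟩
      | right hm => cases hm; exact ⟨_, _, .nil, .irrelevant hn.typed, .relevant hn⟩

theorem Inst.lift_var {σ σ' : Nat → Tm} {Γ Γ' : Ctx} {Δ Δ' : PCtx} {x : Nat} {s : Srt}
    {A : Tm} (h : Lift Inst σ σ' Γ Δ Γ' Δ') (hΓ : PWf Γ Δ) (hx : PHas Δ x s A) :
    Erase Γ' Δ' (σ x) (σ' x) (subst σ A) := by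
  induction h generalizing x s A with
  | base h =>
    cases h with
    | irrelevant => cases hx with
      | succN hx => cases hx
    | relevant hn => cases hx with
      | zero => rw [subst_inst_rename]; exact hn
      | succU hx => cases hx
  | up B e h ih =>
    have hΓ' := Inst.admissible.lift.pwf (h.up B e) hΓ
    cases hx with
    | zero hΔ =>
      rw [rename_succ_subst]
      exact .var hΓ' (.zero (Inst.admissible.lift.restr h hΔ))
    | succN hx =>
      rw [rename_succ_subst]
      cases hΓ with
      | consN hΓ => cases hΓ' with
        | consN _ hB => exact (ih hΓ hx).shift (.none hB)
    | succU hx =>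
      rw [rename_succ_subst]
      cases hΓ with
      | cons hΓ => cases hΓ' with
        | cons _ hB => exact (ih hΓ hx).shift (.unr hB)

theorem Erase.subst1 {Δ : PCtx} {m m' n n' A B : Tm} (h : Erase [A] Δ m m' B)
    (hn : Inst (inst n) (inst n') [A] Δ [] []) :
    Erase [] [] (subst1 n m) (subst1 n' m') (subst1 n B) := by
  simp only [subst1_eq]
  exact h.subst_of_lift Inst.admissible Inst.lift_var (.base hn)

/-! ### Inversion and reduction -/

theorem Erase.lam0_inv {Γ : Ctx} {Δ : PCtx} {t : Srt} {m A' b' C : Tm}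
    (h : Erase Γ Δ m (.lam0 t A' b') C) :
    ∃ A b B, m = .lam0 t A b ∧ Erase (A :: Γ) (none :: Δ) b b' B ∧
      Conv (.pi0 t A B) C := by
  generalize hm : Tm.lam0 t A' b' = m' at h
  induction h with
  | lam0 t hb => cases hm; exact ⟨_, _, _, rfl, hb, .refl _⟩
  | conv _ _ c ih =>
    obtain ⟨A, b, B, e, hb, hc⟩ := ih hm
    exact ⟨A, b, B, e, hb, hc.trans c⟩
  | _ => cases hm

theorem Erase.lam1_inv {Γ : Ctx} {Δ : PCtx} {t : Srt} {m A' b' C : Tm}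
    (h : Erase Γ Δ m (.lam1 t A' b') C) :
    ∃ A b B s, m = .lam1 t A b ∧ Erase (A :: Γ) (some (s, A) :: Δ) b b' B ∧
      Conv (.pi1 t A B) C := by
  generalize hm : Tm.lam1 t A' b' = m' at h
  induction h with
  | lam1 t hb => cases hm; exact ⟨_, _, _, _, rfl, hb, .refl _⟩
  | conv _ _ c ih =>
    obtain ⟨A, b, B, s, e, hb, hc⟩ := ih hm
    exact ⟨A, b, B, s, e, hb, hc.trans c⟩
  | _ => cases hm

theorem Erase.value {Γ : Ctx} {Δ : PCtx} {m m' A : Tm} (h : Erase Γ Δ m m' A)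
    (hv : Value m') : Value m := by
  induction h with
  | var => exact .var
  | lam0 => exact .lam0
  | lam1 => exact .lam1
  | app0 | app1 => cases hv
  | conv _ _ _ ih => exact ih hv

theorem CStep.toLStep {m n : Tm} (h : CStep m n) : LStep m n := by
  induction h with
  | appL _ ih => exact .appL ih
  | appR _ ih => exact .appR ih
  | beta0 => exact .beta0
  | beta1 => exact .beta1

/-- The domain of an abstraction is well-sorted. -/
theorem LWf.head {Γ : Ctx} {A : Tm} (h : LWf (A :: Γ)) : ∃ s, LTyped Γ A (.srt s) := by
  cases h with
  | cons _ hA => exact ⟨_, hA⟩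

/-- Erasure subject reduction. -/
theorem erasure_subject_reduction {m m' n' A : Tm}
    (h : Erase [] [] m m' A) (hr : CStep m' n') :
    ∃ n : Tm, CStep m n ∧ Erase [] [] n n' A := by
  generalize hΓ : ([] : Ctx) = Γ at h
  generalize hΔ : ([] : PCtx) = Δ at h
  induction h generalizing n' with
  | var | lam0 | lam1 => cases hr
  | app0 h hn ih =>
    subst hΓ hΔ
    cases hr with
    | appL hr =>
      obtain ⟨k, hk, hk'⟩ := ih hr rfl rfl
      exact ⟨_, .appL hk, .app0 hk' hn⟩
    | appR hr => cases hr
    | beta0 =>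
      obtain ⟨A₀, b, B₀, rfl, hb, c⟩ := h.lam0_inv
      obtain ⟨cA, cB⟩ := c.pi0_inj
      obtain ⟨_, hA₀⟩ := hb.typed.wf.head
      obtain ⟨_, hB⟩ := (Erase.app0 h hn).typed.validity
      refine ⟨_, .beta0, .conv (hb.subst1 (.irrelevant (hn.conv hA₀ cA.symm))) hB ?_⟩
      simpa only [subst1_eq] using cB.subst _
    | beta1 hv => cases hv
  | app1 h hn hm ih₁ ih₂ =>
    subst hΓ hΔ
    cases hm
    obtain ⟨_, hB⟩ := (Erase.app1 h hn .nil).typed.validity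
    cases hr with
    | appL hr =>
      obtain ⟨k, hk, hk'⟩ := ih₁ hr rfl rfl
      exact ⟨_, .appL hk, .app1 hk' hn .nil⟩
    | appR hr =>
      obtain ⟨k, hk, hk'⟩ := ih₂ hr rfl rfl
      exact ⟨_, .appR hk, .conv (.app1 h hk' .nil) hB
        ((PStep.refl _).subst1 hk.toLStep.toPStep).toConv.symm⟩
    | beta0 =>
      obtain ⟨_, _, _, rfl, _, c⟩ := h.lam0_inv
      exact absurd c Conv.pi0_ne_pi1
    | beta1 hv =>
      obtain ⟨A₀, b, B₀, s, rfl, hb, c⟩ := h.lam1_inv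
      obtain ⟨cA, cB⟩ := c.pi1_inj
      obtain ⟨_, hA₀⟩ := hb.typed.wf.head
      refine ⟨_, .beta1 (hn.value hv),
        .conv (hb.subst1 (.relevant (hn.conv hA₀ cA.symm))) hB ?_⟩
      simpa only [subst1_eq] using cB.subst _
  | conv _ hB c ih =>
    subst hΓ hΔ
    obtain ⟨k, hk, hk'⟩ := ih hr rfl rfl
    exact ⟨k, hk, .conv hk' hB c⟩

end TLL
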